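/- Let T > 0 and let 0 < σ₁² ≤ σ₂² and a > σ₂² be real constants. For a measurable function γ : [0,T] → ℝ with σ₁² ≤ γ(t) ≤ σ₂² for all t, define J(γ) = ∫₀ᵀ ( a t − ∫₀ᵗ γ(s) ds ) γ(t) dt. Let t* = σ₂² T / (a + σ₂² − σ₁²) and γ*(t) = σ₁² for t ∈ [0, t*], γ*(t) = σ₂² for t ∈ (t*, T]. Then t* ∈ (0, T] and J(γ) ≤ J(γ*) for every measurable γ with values in [σ₁², σ₂²]; i.e., γ* maximizes J over all such γ. -/

import Mathlib

open MeasureTheory intervalIntegral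

lemma aux_sq (T : ℝ) (hT : 0 < T) (g : ℝ → ℝ) (hg : IntervalIntegrable g volume 0 T) :
    ∫ t in (0:ℝ)..T, (∫ s in (0:ℝ)..t, g s) * g t = (∫ t in (0:ℝ)..T, g t) ^ 2 / 2 := by
  have hac := hg.absolutelyContinuousOnInterval_intervalIntegral (c := 0) Set.left_mem_uIcc
  have hp := hac.integral_mul_deriv_eq_deriv_mul hac
  have hd : ∀ᵐ t, t ∈ Set.uIoc 0 T → deriv (fun x ↦ ∫ v in (0:ℝ)..x, g v) t = g t := by
    filter_upwards [hg.ae_hasDerivAt_integral] with t ht htm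
    exact (ht (Set.uIoc_subset_uIcc htm) 0 Set.left_mem_uIcc).deriv
  have e1 : ∫ t in (0:ℝ)..T, (∫ s in (0:ℝ)..t, g s) * deriv (fun x ↦ ∫ v in (0:ℝ)..x, g v) t
      = ∫ t in (0:ℝ)..T, (∫ s in (0:ℝ)..t, g s) * g t := by
    apply intervalIntegral.integral_congr_ae
    filter_upwards [hd] with t ht htm
    rw [ht htm]
  have e2 : ∫ t in (0:ℝ)..T, deriv (fun x ↦ ∫ v in (0:ℝ)..x, g v) t * (∫ s in (0:ℝ)..t, g s)
      = ∫ t in (0:ℝ)..T, (∫ s in (0:ℝ)..t, g s) * g t := by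
    rw [← e1]; congr 1; ext t; ring
  rw [e1, e2] at hp
  simp only [integral_same] at hp
  linarith

lemma aux_J (T a : ℝ) (hT : 0 < T) (g : ℝ → ℝ) (hg : IntervalIntegrable g volume 0 T) :
    ∫ t in (0:ℝ)..T, (a * t - ∫ s in (0:ℝ)..t, g s) * g t =
      (∫ t in (0:ℝ)..T, a * t * g t) - (∫ t in (0:ℝ)..T, g t) ^ 2 / 2 := by
  have hac := hg.absolutelyContinuousOnInterval_intervalIntegral (c := 0) Set.left_mem_uIcc
  rw [← aux_sq T hT g hg, ← intervalIntegral.integral_sub]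
  · congr 1; ext t; ring
  · exact hg.continuousOn_mul (by fun_prop)
  · exact hg.continuousOn_mul hac.continuousOn



/-- The deterministic optimization underlying Example 6.3: among measurable quadratic-variation
densities `γ : [0,T] → [σ₁², σ₂²]`, the functional
`J(γ) = ∫₀ᵀ (a t − ∫₀ᵗ γ(s) ds) γ(t) dt` is maximized by the density `γ*` equal to `σ₁²` on
`[0, t*]` and `σ₂²` on `(t*, T]`, where `t* = σ₂² T / (a + σ₂² − σ₁²) ∈ (0, T]`. -/
theorem stmt_10 (T s1 s2 a : ℝ) (hT : 0 < T)
    (hs1 : 0 < s1) (h12 : s1 ≤ s2) (ha : s2 < a) :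
    0 < s2 * T / (a + s2 - s1) ∧ s2 * T / (a + s2 - s1) ≤ T ∧
    ∀ γ : ℝ → ℝ, Measurable γ → (∀ t ∈ Set.Icc (0 : ℝ) T, γ t ∈ Set.Icc s1 s2) →
      (∫ t in (0 : ℝ)..T, (a * t - ∫ s in (0 : ℝ)..t, γ s) * γ t) ≤
        ∫ t in (0 : ℝ)..T,
          (a * t - ∫ s in (0 : ℝ)..t,
              (if s ≤ s2 * T / (a + s2 - s1) then s1 else s2)) *
            (if t ≤ s2 * T / (a + s2 - s1) then s1 else s2) := by

  have hc : 0 < a + s2 - s1 := by linarith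
  have hs2 : 0 < s2 := by linarith
  have h0 : 0 < s2 * T / (a + s2 - s1) := by positivity
  have h1 : s2 * T / (a + s2 - s1) ≤ T := by
    rw [div_le_iff₀ hc]; nlinarith
  refine ⟨h0, h1, ?_⟩
  have hτ : s2 * T / (a + s2 - s1) * (a + s2 - s1) = s2 * T := by field_simp
  generalize s2 * T / (a + s2 - s1) = τ at *
  intro γ hm hb
  have hγ : IntervalIntegrable γ volume 0 T := by
    refine (intervalIntegrable_const (c := s2)).mono_fun hm.aestronglyMeasurable ?_
    filter_upwards [ae_restrict_mem measurableSet_uIoc] with t ht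
    rw [Set.uIoc_of_le hT.le] at ht
    have := hb t ⟨ht.1.le, ht.2⟩
    rw [Real.norm_of_nonneg (hs1.le.trans this.1), Real.norm_of_nonneg hs2.le]
    exact this.2
  have hsm : Measurable (fun s : ℝ ↦ if s ≤ τ then s1 else s2) :=
    Measurable.ite measurableSet_Iic measurable_const measurable_const
  have hs : ∀ u v : ℝ, IntervalIntegrable (fun s : ℝ ↦ if s ≤ τ then s1 else s2) volume u v := by
    intro u v
    refine (intervalIntegrable_const (c := s2)).mono_fun hsm.aestronglyMeasurable ?_
    refine Filter.Eventually.of_forall fun t => ?_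
    rw [Real.norm_of_nonneg hs2.le]
    dsimp only
    split_ifs
    · rwa [Real.norm_of_nonneg hs1.le]
    · rw [Real.norm_of_nonneg hs2.le]
  have hG : ∫ s in (0:ℝ)..T, (if s ≤ τ then s1 else s2) = a * τ := by
    rw [← integral_add_adjacent_intervals (hs 0 τ) (hs τ T)]
    have i1 : ∫ s in (0:ℝ)..τ, (if s ≤ τ then s1 else s2) = ∫ s in (0:ℝ)..τ, s1 := by
      apply intervalIntegral.integral_congr_ae
      refine Filter.Eventually.of_forall fun t ht => ?_
      rw [Set.uIoc_of_le h0.le] at ht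
      exact if_pos ht.2
    have i2 : ∫ s in τ..T, (if s ≤ τ then s1 else s2) = ∫ s in τ..T, s2 := by
      apply intervalIntegral.integral_congr_ae
      refine Filter.Eventually.of_forall fun t ht => ?_
      rw [Set.uIoc_of_le h1] at ht
      exact if_neg (not_le.2 ht.1)
    rw [i1, i2]
    simp only [intervalIntegral.integral_const, smul_eq_mul]
    linarith
  rw [aux_J T a hT γ hγ, aux_J T a hT _ (hs 0 T), hG]
  have k1 : IntervalIntegrable (fun t ↦ a * t * γ t) volume 0 T :=
    hγ.continuousOn_mul (by fun_prop)
  have k2 : IntervalIntegrable (fun t ↦ a * t * (if t ≤ τ then s1 else s2)) volume 0 T :=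
    (hs 0 T).continuousOn_mul (by fun_prop)
  have key : ∫ t in (0:ℝ)..T, (a * t * γ t - a * τ * γ t) ≤
      ∫ t in (0:ℝ)..T, (a * t * (if t ≤ τ then s1 else s2)
        - a * τ * (if t ≤ τ then s1 else s2)) := by
    refine intervalIntegral.integral_mono_on hT.le (k1.sub (hγ.const_mul _)) (k2.sub ((hs 0 T).const_mul _)) ?_
    intro t ht
    have hbt := hb t ht
    have ha0 : 0 < a := by linarith
    split_ifs with h
    · nlinarith [mul_nonneg ha0.le (mul_nonneg (sub_nonneg.2 h) (sub_nonneg.2 hbt.1))]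
    · nlinarith [mul_nonneg ha0.le
        (mul_nonneg (sub_nonneg.2 (not_le.1 h).le) (sub_nonneg.2 hbt.2))]
  rw [intervalIntegral.integral_sub k1 (hγ.const_mul _), intervalIntegral.integral_sub k2 ((hs 0 T).const_mul _),
    intervalIntegral.integral_const_mul (a * τ), intervalIntegral.integral_const_mul (a * τ), hG] at key
  nlinarith [sq_nonneg ((∫ t in (0:ℝ)..T, γ t) - a * τ)]
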